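/- arXiv:1403.3064 — 2 statements merged into one kernel-verified Lean document; each statement's English description precedes it below -/
import Mathlib

section
/- Let F be a field of characteristic 2, let π̃ be an n-fold bilinear Pfister form over F with associated totally singular quasi-Pfister form π, let q be a nonsingular quadratic form over F, and set φ ≅ π̃ ⊗ q. Let x ∈ F* and suppose that φ is anisotropic and that π ⊥ ⟨x⟩ is dominated by φ. Then π ⊥ xπ is dominated by φ. -/
open QuadraticMap

variable (F : Type) [Field F]

/-- Quadratic forms on `Fin n → F`. -/
abbrev QF (n : ℕ) := QuadraticForm F (Fin n → F)

/-- The nonsingular binary quadratic form `[a,b] = a x² + x y + b y²`. -/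
noncomputable def binQF (a b : F) : QF F 2 :=
  (Matrix.of ![![a, 1], ![0, b]]).toQuadraticMap'

/-- The totally singular diagonal quadratic form `⟨c₁, …, c_n⟩ = Σ cᵢ xᵢ²`. -/
noncomputable def diagQF {n : ℕ} (c : Fin n → F) : QF F n :=
  QuadraticMap.weightedSumSquares F c

/-- Orthogonal sum of a finite family of quadratic forms of the same dimension. -/
noncomputable def oSumFam {k n : ℕ} (q : Fin k → QF F n) : QF F (k * n) :=
  (QuadraticMap.pi q).comp
    ((LinearEquiv.curry F F (Fin k) (Fin n)).toLinearMap.comp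
      (LinearEquiv.funCongrLeft F F finProdFinEquiv).toLinearMap)

/-- Orthogonal sum of two quadratic forms. -/
noncomputable def oSum {n m : ℕ} (q₁ : QF F n) (q₂ : QF F m) : QF F (n + m) :=
  (QuadraticMap.prod q₁ q₂).comp
    ((LinearEquiv.sumArrowLequivProdArrow (Fin n) (Fin m) F F).toLinearMap.comp
      (LinearEquiv.funCongrLeft F F finSumFinEquiv).toLinearMap)

section General
variable {M N : Type} [AddCommGroup M] [Module F M] [AddCommGroup N] [Module F N]

/-- Two quadratic forms are isometric if there is an isometry (isomorphism preserving the
form) between them. -/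
def QIsometric (q₁ : QuadraticForm F M) (q₂ : QuadraticForm F N) : Prop :=
  Nonempty (QuadraticMap.IsometryEquiv q₁ q₂)

/-- `q₁` is dominated by `q₂` (written `q₁ ≺ q₂`) if there is an injective linear map `t`
with `q₁ x = q₂ (t x)` for all `x`. -/
def Dominates (q₁ : QuadraticForm F M) (q₂ : QuadraticForm F N) : Prop :=
  ∃ t : M →ₗ[F] N, Function.Injective t ∧ ∀ x, q₁ x = q₂ (t x)

/-- A quadratic form is nonsingular if the radical of its polar form is trivial. -/
def Nonsingular (q : QuadraticForm F M) : Prop :=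
  ∀ x, (∀ y, polar q x y = 0) → x = 0

/-- A quadratic form is totally singular if its polar form vanishes identically. -/
def TotallySingular (q : QuadraticForm F M) : Prop :=
  ∀ x y, polar q x y = 0

/-- A quadratic form is hyperbolic if it is isometric to an orthogonal sum of
hyperbolic planes `ℍ = [0,0]`. -/
def Hyperbolic (q : QuadraticForm F M) : Prop :=
  ∃ k : ℕ, QIsometric F q (oSumFam F fun _ : Fin k => binQF F 0 0)

/-- Witt equivalence: two quadratic forms are Witt equivalent iff they have isometric
anisotropic parts, i.e. both are isometric to `i × ℍ ⊥ ρ ⊥ j × ⟨0⟩` for a common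
anisotropic form `ρ`. -/
def WittEquiv (q₁ : QuadraticForm F M) (q₂ : QuadraticForm F N) : Prop :=
  ∃ (r : ℕ) (ρ : QF F r), ρ.Anisotropic ∧
    (∃ i j : ℕ, QIsometric F q₁
      (oSum F (oSum F (oSumFam F fun _ : Fin i => binQF F 0 0) ρ) (diagQF F (0 : Fin j → F)))) ∧
    (∃ i j : ℕ, QIsometric F q₂
      (oSum F (oSum F (oSumFam F fun _ : Fin i => binQF F 0 0) ρ) (diagQF F (0 : Fin j → F))))

end General

/-- The Gram-type matrix of a quadratic form on `Fin n → F`: diagonal entries are the values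
on basis vectors, above-diagonal entries the polar values. -/
noncomputable def qMat {n : ℕ} (q : QF F n) : Matrix (Fin n) (Fin n) F :=
  Matrix.of fun i j =>
    if i = j then q (Pi.single i 1)
    else if i < j then polar q (Pi.single i 1) (Pi.single j 1) else 0

/-- Scalar extension of a quadratic form along `F → E`. -/
noncomputable def extQF (E : Type) [CommRing E] [Algebra F E] {n : ℕ} (q : QF F n) :
    QuadraticForm E (Fin n → E) :=
  ((qMat F q).map (algebraMap F E)).toQuadraticMap'

/-- Membership of the Witt class of `q` in the kernel `W_q(E/F)` of `W_qF → W_qE`: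
the scalar extension of `q` is Witt equivalent to the zero form. -/
def InWqKernel (E : Type) [Field E] [Algebra F E] {n : ℕ} (q : QF F n) : Prop :=
  WittEquiv E (extQF F E q) (0 : QF E 0)

/-- The 2-fold quadratic Pfister form `⟨⟨g,h]] = ⟨1,g⟩_b ⊗ [1,h] = [1,h] ⊥ g[1,h]`. -/
noncomputable def pf2 (g h : F) : QF F 4 :=
  oSum F (binQF F 1 h) (g • binQF F 1 h)

/-- The 3-fold quadratic Pfister form `⟨⟨g₁,g₂,h]] = ⟨1,g₁⟩_b ⊗ ⟨1,g₂⟩_b ⊗ [1,h]`. -/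
noncomputable def pf3 (g₁ g₂ h : F) : QF F 8 :=
  oSum F (pf2 F g₂ h) (g₁ • pf2 F g₂ h)

/-- Orthogonal sum of a list of quadratic forms of varying dimensions. -/
noncomputable def listOSum : List (Σ n, QF F n) → Σ n, QF F n
  | [] => ⟨0, 0⟩
  | x :: L => ⟨x.1 + (listOSum L).1, oSum F x.2 (listOSum L).2⟩

/-- The cubic resolvent `f_C(X) = X³ + bX² + acX + (a²d + c²)` of
`f(X) = X⁴ + aX³ + bX² + cX + d`, evaluated at `e`. -/
def cubicResolvent (a b c d e : F) : F := e ^ 3 + b * e ^ 2 + a * c * e + (a ^ 2 * d + c ^ 2)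

open scoped symmDiff

section Reflections

variable {K V : Type*} [Field K] [AddCommGroup V] [Module K V]

/-- The reflection `y ↦ y - Q(v)⁻¹ b_Q(y, v) v` along `v`. -/
noncomputable def QuadraticMap.reflect (Q : QuadraticForm K V) (v : V) : V →ₗ[K] V :=
  LinearMap.id - ((Q v)⁻¹ • (polarBilin Q).flip v).smulRight v

theorem QuadraticMap.reflect_apply (Q : QuadraticForm K V) (v y : V) :
    reflect Q v y = y - ((Q v)⁻¹ * polar Q y v) • v := by
  simp [reflect]

theorem QuadraticMap.map_reflect (Q : QuadraticForm K V) {v : V} (hv : Q v ≠ 0) (y : V) :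
    Q (reflect Q v y) = Q y := by
  rw [reflect_apply, sub_eq_add_neg, ← neg_smul, QuadraticMap.map_add Q, QuadraticMap.map_smul,
    polar_smul_right]
  simp only [smul_eq_mul]
  field_simp
  ring

/-- Witt's extension theorem for anisotropic forms: two finite families of vectors with the same
values and the same polar values are related by a form-preserving endomorphism. -/
theorem QuadraticMap.Anisotropic.exists_map_eq {Q : QuadraticForm K V} (hQ : Q.Anisotropic)
    {ι : Type*} (f g : ι → V) (hval : ∀ i, Q (f i) = Q (g i))
    (hpolar : ∀ i j, polar Q (f i) (f j) = polar Q (g i) (g j)) (s : Finset ι) :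
    ∃ σ : V →ₗ[K] V, (∀ v, Q (σ v) = Q v) ∧ ∀ i ∈ s, σ (f i) = g i := by
  classical
  induction s using Finset.induction_on with
  | empty => exact ⟨LinearMap.id, fun _ => rfl, by simp⟩
  | insert i s _ ih =>
    obtain ⟨σ, hσ, hσs⟩ := ih
    have hσp (v w : V) : polar Q (σ v) (σ w) = polar Q v w := by
      simp only [polar, ← _root_.map_add, hσ]
    by_cases hi : σ (f i) = g i
    · exact ⟨σ, hσ, by simpa [hi] using hσs⟩
    have hne : Q (σ (f i) - g i) ≠ 0 := fun h => hi (sub_eq_zero.mp (hQ _ h))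
    refine ⟨reflect Q (σ (f i) - g i) ∘ₗ σ, fun v => ?_, fun j hj => ?_⟩
    · rw [LinearMap.comp_apply, map_reflect Q hne, hσ]
    rw [LinearMap.comp_apply, reflect_apply]
    rcases Finset.mem_insert.mp hj with rfl | hj
    · have hsub : polar Q (σ (f j)) (σ (f j) - g j) = Q (σ (f j) - g j) := by
        have hd : Q (σ (f j) - g j) = Q (σ (f j)) + Q (g j) - polar Q (σ (f j)) (g j) := by
          rw [sub_eq_add_neg, QuadraticMap.map_add Q, QuadraticMap.map_neg, polar_neg_right]
          ring
        rw [hd, polar_sub_right, polar_self, hσ, hval]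
        simp only [two_smul]
      rw [hsub, inv_mul_cancel₀ hne, one_smul, sub_sub_cancel]
    · have hsub : polar Q (σ (f j)) (σ (f i) - g i) = 0 := by
        rw [polar_sub_right, hσp, hσs j hj, hpolar, sub_self]
      rw [hsub, mul_zero, zero_smul, sub_zero, hσs j hj]

theorem QuadraticMap.map_sum_of_polar_eq_zero (Q : QuadraticForm K V) {ι : Type*} (s : Finset ι)
    (k : ι → K) (c : ι → V) (h : ∀ i j, i ≠ j → polar Q (c i) (c j) = 0) :
    Q (∑ i ∈ s, k i • c i) = ∑ i ∈ s, Q (c i) * (k i * k i) := by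
  classical
  induction s using Finset.induction_on with
  | empty => simp
  | insert i s hi ih =>
    have hz : polar Q (k i • c i) (∑ j ∈ s, k j • c j) = 0 := by
      rw [← polarBilin_apply_apply, map_sum]
      refine Finset.sum_eq_zero fun j hj => ?_
      have hij : i ≠ j := fun e => hi (e ▸ hj)
      simp [h i j hij]
    rw [Finset.sum_insert hi, Finset.sum_insert hi, QuadraticMap.map_add Q, hz, ih,
      QuadraticMap.map_smul, smul_eq_mul]
    ring

end Reflections

section Finset

variable {R ι : Type*} [CommMonoid R] [DecidableEq ι]

theorem Finset.prod_mul_prod_sdiff (a : ι → R) (S U : Finset ι) :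
    (∏ i ∈ U, a i) * ∏ i ∈ S \ U, a i = ∏ i ∈ S ∪ U, a i := by
  rw [mul_comm, ← Finset.prod_union Finset.sdiff_disjoint, Finset.sdiff_union_self_eq_union]

theorem Finset.union_symmDiff_self (S U : Finset ι) : S ∪ S ∆ U = S ∪ U := by
  ext i
  simp only [Finset.mem_union, Finset.mem_symmDiff]
  tauto

theorem Finset.prod_eq_prod_ite_mem [Fintype ι] (s : Finset ι) (a : ι → R) :
    ∏ i ∈ s, a i = ∏ i, if i ∈ s then a i else 1 := by
  simp [Finset.prod_ite_mem]

end Finset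

section PfisterMul

variable {R M ι : Type*} [CommRing R] [AddCommGroup M] [Module R M] [Fintype ι]

/-- The quadratic form `⟨⟨a_i : i ∈ ι⟩⟩_b ⊗ q`. -/
noncomputable def pfisterMul (a : ι → R) (q : QuadraticForm R M) :
    QuadraticForm R (Finset ι → M) :=
  QuadraticMap.pi fun S : Finset ι => (∏ i ∈ S, a i) • q

variable (a : ι → R) (q : QuadraticForm R M)

theorem pfisterMul_apply (w : Finset ι → M) :
    pfisterMul a q w = ∑ S : Finset ι, (∏ i ∈ S, a i) * q (w S) := by
  simp [pfisterMul, QuadraticMap.pi_apply]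

theorem polar_pfisterMul (v w : Finset ι → M) :
    polar (pfisterMul a q) v w = ∑ S : Finset ι, (∏ i ∈ S, a i) * polar q (v S) (w S) := by
  simp only [polar, pfisterMul_apply, Pi.add_apply, ← Finset.sum_sub_distrib, mul_sub]

end PfisterMul

section Twist

variable {R M ι : Type*} [CommRing R] [AddCommGroup M] [Module R M] [DecidableEq ι]

/-- Multiplication by `∏ i ∈ S, √(a i)` on `M ⊗ R(√(a i) : i ∈ ι)`, in the coordinates given by the
basis of products of square roots. -/
def twist (a : ι → R) (S : Finset ι) : (Finset ι → M) →ₗ[R] (Finset ι → M) where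
  toFun w U := (∏ i ∈ S \ U, a i) • w (S ∆ U)
  map_add' v w := by ext U; simp
  map_smul' c w := by ext U; simp [smul_comm c]

theorem twist_apply (a : ι → R) (S : Finset ι) (w : Finset ι → M) (U : Finset ι) :
    twist a S w U = (∏ i ∈ S \ U, a i) • w (S ∆ U) := rfl

variable [Fintype ι]

theorem twist_twist (a : ι → R) (S T : Finset ι) (w : Finset ι → M) :
    twist a S (twist a T w) = (∏ i ∈ S ∩ T, a i) • twist a (S ∆ T) w := by
  ext U
  simp only [twist_apply, Pi.smul_apply, smul_smul]
  rw [← symmDiff_assoc, symmDiff_comm T S]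
  congr 1
  simp only [Finset.prod_eq_prod_ite_mem _ a, ← Finset.prod_mul_distrib]
  refine Finset.prod_congr rfl fun i _ => ?_
  by_cases hS : i ∈ S <;> by_cases hT : i ∈ T <;> by_cases hU : i ∈ U <;>
    simp [Finset.mem_symmDiff, hS, hT, hU]

variable (a : ι → R) (q : QuadraticForm R M)

theorem pfisterMul_twist (S : Finset ι) (w : Finset ι → M) :
    pfisterMul a q (twist a S w) = (∏ i ∈ S, a i) * pfisterMul a q w := by
  simp only [pfisterMul_apply, twist_apply, QuadraticMap.map_smul, Finset.mul_sum, smul_eq_mul]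
  refine Fintype.sum_equiv (symmDiff_right_involutive S).toPerm _ _ fun U => ?_
  simp only [Function.Involutive.coe_toPerm, ← mul_assoc]
  congr 1
  simp only [Finset.prod_eq_prod_ite_mem _ a, ← Finset.prod_mul_distrib]
  refine Finset.prod_congr rfl fun i _ => ?_
  by_cases hS : i ∈ S <;> by_cases hU : i ∈ U <;> simp [Finset.mem_symmDiff, hS, hU]

theorem polar_pfisterMul_twist_right (S : Finset ι) (v w : Finset ι → M) :
    polar (pfisterMul a q) v (twist a S w) =
      ∑ U : Finset ι, (∏ i ∈ S ∪ U, a i) * polar q (v U) (w (S ∆ U)) := by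
  simp only [polar_pfisterMul, twist_apply, polar_smul_right, smul_eq_mul, ← mul_assoc,
    Finset.prod_mul_prod_sdiff]

theorem polar_pfisterMul_twist_left (S : Finset ι) (v w : Finset ι → M) :
    polar (pfisterMul a q) (twist a S v) w = polar (pfisterMul a q) v (twist a S w) := by
  rw [polar_comm, polar_pfisterMul_twist_right, polar_pfisterMul_twist_right]
  refine Fintype.sum_equiv (symmDiff_right_involutive S).toPerm _ _ fun U => ?_
  simp only [Function.Involutive.coe_toPerm, Finset.union_symmDiff_self,
    symmDiff_symmDiff_cancel_left]
  rw [polar_comm]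

theorem polar_pfisterMul_self_twist [CharP R 2] (S : Finset ι) (w : Finset ι → M) :
    polar (pfisterMul a q) w (twist a S w) = 0 := by
  rw [polar_pfisterMul_twist_right]
  refine Finset.sum_involution (fun U _ => S ∆ U) (fun U _ => ?_) (fun U _ hU hfix => hU ?_)
    (fun _ _ => Finset.mem_univ _) (fun U _ => symmDiff_symmDiff_cancel_left S U)
  · rw [Finset.union_symmDiff_self, symmDiff_symmDiff_cancel_left, polar_comm q (w (S ∆ U)),
      CharTwo.add_self_eq_zero]
  · simp only [hfix, polar_self, two_smul, CharTwo.add_self_eq_zero, mul_zero]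

theorem polar_pfisterMul_twist_twist (S T : Finset ι) (v w : Finset ι → M) :
    polar (pfisterMul a q) (twist a S v) (twist a T w) =
      (∏ i ∈ S ∩ T, a i) * polar (pfisterMul a q) v (twist a (S ∆ T) w) := by
  rw [polar_pfisterMul_twist_left, twist_twist, polar_smul_right, smul_eq_mul]

/-- The action of `R(√(a i) : i ∈ ι)` on a fixed vector `w`, as a linear map. -/
noncomputable def twistSum (w : Finset ι → M) : (Finset ι → R) →ₗ[R] (Finset ι → M) :=
  Fintype.linearCombination R fun S => twist a S w

theorem twistSum_apply (w : Finset ι → M) (k : Finset ι → R) :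
    twistSum a w k = ∑ S, k S • twist a S w := by
  simp [twistSum, Fintype.linearCombination_apply]

theorem twist_mem_range_twistSum (S : Finset ι) {v w : Finset ι → M}
    (hv : v ∈ LinearMap.range (twistSum a w)) : twist a S v ∈ LinearMap.range (twistSum a w) := by
  obtain ⟨k, rfl⟩ := hv
  rw [twistSum_apply, map_sum]
  refine Submodule.sum_mem _ fun T _ => ?_
  rw [map_smul, twist_twist]
  refine Submodule.smul_mem _ _ (Submodule.smul_mem _ _ ⟨Pi.single (S ∆ T) 1, ?_⟩)
  simp [twistSum, Fintype.linearCombination_apply_single]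

theorem twistSum_mem_range_twistSum {v w : Finset ι → M}
    (hv : v ∈ LinearMap.range (twistSum a w)) (k : Finset ι → R) :
    twistSum a v k ∈ LinearMap.range (twistSum a w) := by
  rw [twistSum_apply]
  exact Submodule.sum_mem _ fun S _ => Submodule.smul_mem _ _ (twist_mem_range_twistSum a S hv)

theorem polar_pfisterMul_twistSum_twistSum {v w : Finset ι → M}
    (h : ∀ S, polar (pfisterMul a q) (twist a S v) w = 0) (k l : Finset ι → R) :
    polar (pfisterMul a q) (twistSum a v k) (twistSum a w l) = 0 := by
  simp only [polar_pfisterMul_twist_left] at h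
  rw [← polarBilin_apply_apply, twistSum_apply, twistSum_apply]
  simp [LinearMap.sum_apply, polar_pfisterMul_twist_twist, h]

end Twist

section Field

variable {K M ι : Type*} [Field K] [CharP K 2] [AddCommGroup M] [Module K M] [Fintype ι]
  [DecidableEq ι] (a : ι → K) (q : QuadraticForm K M)

theorem pfisterMul_twistSum (w : Finset ι → M) (k : Finset ι → K) :
    pfisterMul a q (twistSum a w k) =
      weightedSumSquares K (fun S : Finset ι => ∏ i ∈ S, a i) k * pfisterMul a q w := by
  rw [twistSum_apply, map_sum_of_polar_eq_zero, weightedSumSquares_apply, Finset.sum_mul]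
  · refine Finset.sum_congr rfl fun S _ => ?_
    rw [pfisterMul_twist, smul_eq_mul]
    ring
  · intro S T _
    rw [polar_pfisterMul_twist_twist, polar_pfisterMul_self_twist, mul_zero]

end Field

/-- if `π̃ = ⟨⟨a₁,…,a_n⟩⟩_b` is an `n`-fold bilinear Pfister form with associated
quasi-Pfister form `π`, `q` is nonsingular, `φ ≅ π̃ ⊗ q` (concretely, the orthogonal sum over all
subsets `S ⊆ {1,…,n}` of `(∏_{i∈S} aᵢ) q`), `φ` is anisotropic and `π ⊥ ⟨x⟩ ≺ φ`,
then `π ⊥ xπ ≺ φ`. -/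
theorem stmt_2 (F : Type) [Field F] [CharP F 2] (n m : ℕ) (a : Fin n → F) (ha : ∀ i, a i ≠ 0)
    (q : QF F m) (hq : Nonsingular F q) (x : F) (hx : x ≠ 0)
    (φ : QuadraticForm F (Finset (Fin n) → Fin m → F))
    (hφ : φ = QuadraticMap.pi fun S : Finset (Fin n) => (∏ i ∈ S, a i) • q)
    (π : QuadraticForm F (Finset (Fin n) → F))
    (hπ : π = QuadraticMap.weightedSumSquares F fun S : Finset (Fin n) => ∏ i ∈ S, a i)
    (han : φ.Anisotropic)
    (hdom : Dominates F (QuadraticMap.prod π (diagQF F ![x])) φ) :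
    Dominates F (QuadraticMap.prod π (x • π)) φ := by
  obtain ⟨t, ht, htφ⟩ := hdom
  replace hφ : φ = pfisterMul a q := hφ
  have htval (k : Finset (Fin n) → F) (y : F) : φ (t (k, ![y])) = π k + x * (y * y) := by
    rw [← htφ]
    simp [diagQF, weightedSumSquares_apply]
  have hani {k : Finset (Fin n) → F} {y : F} (h : π k + x * (y * y) = 0) : k = 0 ∧ y = 0 := by
    have h0 := (map_eq_zero_iff t ht).mp (han _ ((htval k y).trans h))
    rw [Prod.mk_eq_zero] at h0
    exact ⟨h0.1, congrFun h0.2 0⟩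
  have hπsingle (S : Finset (Fin n)) : π (Pi.single S 1) = ∏ i ∈ S, a i := by
    rw [hπ, weightedSumSquares_apply, Finset.sum_eq_single S] <;> simp +contextual
  have hπadd (k l : Finset (Fin n) → F) : π (k + l) = π k + π l := by
    simp only [hπ, weightedSumSquares_apply, ← Finset.sum_add_distrib, Pi.add_apply,
      CharTwo.add_mul_self, smul_add]
  set u := t (Pi.single ∅ 1, ![0]) with hu
  have hφu : φ u = 1 := by simp [hu, htval, hπsingle]
  have hφM (w : Finset (Fin n) → Fin m → F) (k : Finset (Fin n) → F) :
      φ (twistSum a w k) = π k * φ w := by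
    rw [hφ, hπ, pfisterMul_twistSum]
  obtain ⟨σ, hσ, hσt⟩ := han.exists_map_eq (fun S => t (Pi.single S 1, ![0]))
    (fun S => twist a S u)
    (fun S => by
      rw [htval, hπsingle, hφ, pfisterMul_twist, ← hφ, hφu]
      ring)
    (fun S T => by
      rw [hφ, polar_pfisterMul_twist_twist, polar_pfisterMul_self_twist, ← hφ, mul_zero]
      simp only [polar, ← _root_.map_add, Prod.mk_add_mk, Matrix.cons_add_cons,
        Matrix.empty_add_empty, htval, hπadd]
      ring)
    Finset.univ
  set w := σ (t (0, ![1])) with hw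
  have hφw : φ w = x := by simp [hw, hσ, htval]
  have hperp (S : Finset (Fin n)) : polar φ (twist a S u) w = 0 := by
    rw [← hσt S (Finset.mem_univ S)]
    simp [hw, polar, ← _root_.map_add, hσ, htval]
  have hval (z : (Finset (Fin n) → F) × (Finset (Fin n) → F)) :
      QuadraticMap.prod π (x • π) z = φ ((twistSum a u).coprod (twistSum a w) z) := by
    have h0 : polar φ (twistSum a u z.1) (twistSum a w z.2) = 0 := by
      rw [hφ] at hperp ⊢
      exact polar_pfisterMul_twistSum_twistSum a q hperp _ _
    rw [LinearMap.coprod_apply, QuadraticMap.map_add φ, h0, hφM, hφM, hφu, hφw]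
    simp [mul_comm]
  refine ⟨_, (injective_iff_map_eq_zero _).mpr fun ⟨k, l⟩ hz => ?_, hval⟩
  have h0 : π k + x * π l = 0 := by
    simpa [hz] using hval (k, l)
  obtain ⟨c, hc⟩ := twistSum_mem_range_twistSum a (LinearMap.mem_range_self (twistSum a u) k) l
  have hπc : π c = π l * π k := by
    simpa [hφM, hφu] using congrArg φ hc
  have hl : π l = 0 := (hani (k := c) (y := π l) (by rw [hπc]; linear_combination π l * h0)).2
  have hl0 : l = 0 := (hani (k := l) (y := 0) (by simp [hl])).1
  have hk0 : k = 0 := (hani (k := k) (y := 0) (by simpa [hl] using h0)).1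
  rw [hk0, hl0, Prod.mk_zero_zero]
end

section
/- Let F be a field of characteristic 2 and let E = F(α) be a simple field extension of degree 4, where α has minimal polynomial f(X) = X⁴ + aX³ + bX² + cX + d ∈ F[X], with cubic resolvent f_C(X) = X³ + bX² + acX + (a²d + c²). Then for every e ∈ F* with f_C(e) ≠ 0, the 2-fold quadratic Pfister form ⟨⟨f_C(e), d/e²]] becomes hyperbolic over E, i.e. its Witt class lies in W_q(E/F). -/
open QuadraticMap

variable (F : Type) [Field F]

section Evaluation
variable {F : Type} [Field F]

theorem toQuadraticMap'_apply_sum {n : ℕ} (M : Matrix (Fin n) (Fin n) F) (v : Fin n → F) :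
    M.toQuadraticMap' v = ∑ i, ∑ j, v i * M i j * v j := by
  simp [Matrix.toQuadraticMap', Matrix.toQuadraticForm', LinearMap.BilinMap.toQuadraticMap_apply,
    Matrix.toLinearMap₂'_apply, mul_comm, mul_left_comm]

theorem binQF_apply (a b : F) (v : Fin 2 → F) :
    binQF F a b v = a * v 0 ^ 2 + v 0 * v 1 + b * v 1 ^ 2 := by
  simp only [binQF, toQuadraticMap'_apply_sum, Fin.sum_univ_two, Matrix.of_apply,
    Matrix.cons_val_zero, Matrix.cons_val_one]
  ring

theorem oSum_apply {n m : ℕ} (q₁ : QF F n) (q₂ : QF F m) (v : Fin (n + m) → F) :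
    oSum F q₁ q₂ v = q₁ (fun i => v (Fin.castAdd m i)) + q₂ (fun i => v (Fin.natAdd n i)) :=
  rfl

theorem oSumFam_apply {k n : ℕ} (q : Fin k → QF F n) (v : Fin (k * n) → F) :
    oSumFam F q v = ∑ i, q i (fun j => v (finProdFinEquiv (i, j))) := by
  simp only [oSumFam, QuadraticMap.comp_apply, QuadraticMap.pi_apply]
  rfl

theorem pf2_apply (g h : F) (v : Fin 4 → F) :
    pf2 F g h v = v 0 ^ 2 + v 0 * v 1 + h * v 1 ^ 2
      + g * (v 2 ^ 2 + v 2 * v 3 + h * v 3 ^ 2) := by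
  have key : pf2 F g h v = binQF F 1 h ![v 0, v 1] + g * binQF F 1 h ![v 2, v 3] := by
    refine (oSum_apply (n := 2) (m := 2) _ _ v).trans ?_
    rw [_root_.smul_apply, smul_eq_mul]
    congr 3 <;> ext i <;> fin_cases i <;> rfl
  rw [key, binQF_apply, binQF_apply]
  simp

theorem extQF_pf2_apply (E : Type) [Field E] [Algebra F E] (g h : F) (v : Fin 4 → E) :
    extQF F E (pf2 F g h) v = v 0 ^ 2 + v 0 * v 1 + algebraMap F E h * v 1 ^ 2
      + algebraMap F E g * (v 2 ^ 2 + v 2 * v 3 + algebraMap F E h * v 3 ^ 2) := by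
  simp only [extQF, toQuadraticMap'_apply_sum, Fin.sum_univ_four, Matrix.map_apply, qMat,
    Matrix.of_apply, polar, pf2_apply]
  simp
  ring

theorem QF_zero_apply (q : QF F 0) (v : Fin 0 → F) : q v = 0 := by
  rw [Subsingleton.elim v 0, QuadraticMap.map_zero]

end Evaluation

section Hyperbolic
variable {E : Type} [Field E]

/-- A quadratic form isometric to `2 × ℍ` is Witt equivalent to the zero form. -/
theorem wittEquiv_zero_of_linearEquiv {q : QF E 4} (φ : (Fin 4 → E) ≃ₗ[E] (Fin 4 → E))
    (hφ : ∀ v, φ v 0 * φ v 1 + φ v 2 * φ v 3 = q v) : WittEquiv E q (0 : QF E 0) := by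
  refine ⟨0, 0, fun v _ => Subsingleton.elim _ _, ⟨2, 0, ⟨⟨φ, fun v => ?_⟩⟩⟩,
    ⟨0, 0, ⟨⟨LinearEquiv.refl E (Fin 0 → E), fun v => ?_⟩⟩⟩⟩
  · rw [← hφ v]
    refine (oSum_apply _ _ _).trans ?_
    rw [oSum_apply, QF_zero_apply, QF_zero_apply, oSumFam_apply, Fin.sum_univ_two,
      binQF_apply, binQF_apply]
    simp only [zero_mul, zero_add, add_zero]
    rfl
  · exact QF_zero_apply _ _

/-- In characteristic `2`, if the nonzero scalar `g` is represented by `[1, h]`, then the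
form `[1, h] ⊥ g [1, h]` is Witt equivalent to zero. -/
theorem wittEquiv_zero_of_represents [CharP E 2] {q : QF E 4} {g h x y : E} (hg : g ≠ 0)
    (hxy : x ^ 2 + x * y + h * y ^ 2 = g)
    (hq : ∀ v, q v = v 0 ^ 2 + v 0 * v 1 + h * v 1 ^ 2
      + g * (v 2 ^ 2 + v 2 * v 3 + h * v 3 ^ 2)) : WittEquiv E q (0 : QF E 0) := by
  have h2 : (2 : E) = 0 := CharTwo.two_eq_zero
  let φ : (Fin 4 → E) →ₗ[E] (Fin 4 → E) := Matrix.toLin' (Matrix.of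
    ![![1, 0, x, h * y], ![1, 0, x + y, h * y + x + y], ![0, 1, y, x + y],
      ![1, h, h * y, h * (x + y)]])
  have φ0 (v) : φ v 0 = v 0 + x * v 2 + h * y * v 3 := by
    simp [φ, Matrix.mulVec, dotProduct, Fin.sum_univ_four]
  have φ1 (v) : φ v 1 = v 0 + (x + y) * v 2 + (h * y + x + y) * v 3 := by
    simp [φ, Matrix.mulVec, dotProduct, Fin.sum_univ_four]
  have φ2 (v) : φ v 2 = v 1 + y * v 2 + (x + y) * v 3 := by
    simp [φ, Matrix.mulVec, dotProduct, Fin.sum_univ_four]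
  have φ3 (v) : φ v 3 = v 0 + h * v 1 + h * y * v 2 + h * (x + y) * v 3 := by
    simp [φ, Matrix.mulVec, dotProduct, Fin.sum_univ_four]
  have hinj : Function.Injective φ := by
    rw [injective_iff_map_eq_zero]
    intro v hv
    have e0 := φ0 v
    have e1 := φ1 v
    have e2 := φ2 v
    have e3 := φ3 v
    rw [hv, Pi.zero_apply] at e0 e1 e2 e3
    have v0 : v 0 = 0 := by linear_combination h * e2 - e3
    have v1 : v 1 = 0 := by linear_combination e1 - e0 - e2
    have v3 : v 3 = 0 := by
      refine (mul_eq_zero.1 ?_).resolve_left hg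
      linear_combination x * e2 - y * e0 - v 3 * hxy - y * v0 + x * v1
        + (x ^ 2 + x * y) * v 3 * h2
    have v2 : v 2 = 0 := by
      refine (mul_eq_zero.1 ?_).resolve_left hg
      linear_combination h * y * e2 - (x + y) * e0 - v 2 * hxy - (x + y) * v0 + h * y * v1
        + h * y ^ 2 * v 2 * h2
    ext i
    fin_cases i <;> assumption
  refine wittEquiv_zero_of_linearEquiv (LinearEquiv.ofInjectiveEndo φ hinj) fun v => ?_
  rw [LinearEquiv.coe_ofInjectiveEndo, hq, φ0, φ1, φ2, φ3, ← hxy]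
  linear_combination (v 0 * x * v 2 + v 0 * x * v 3 + v 0 * v 2 * y + v 0 * h * y * v 3
    + v 0 * y * v 3 + x * v 2 * h * y * v 3 * 2 + x * h * y * v 3 ^ 2 + x * h * v 3 * v 1
    + v 2 * h * y * v 1 + v 2 * h * y ^ 2 * v 3 + h * y * v 3 * v 1 + h * y ^ 2 * v 3 ^ 2) * h2

end Hyperbolic

/-- for a simple quartic extension `E = F(α)` in characteristic 2 with minimal
polynomial `f(X) = X⁴ + aX³ + bX² + cX + d` and cubic resolvent
`f_C(X) = X³ + bX² + acX + (a²d + c²)`, the 2-fold quadratic Pfister form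
`⟨⟨f_C(e), d/e²]]` lies in `W_q(E/F)` for every `e ∈ F*` with `f_C(e) ≠ 0`. -/
theorem stmt_5 (F : Type) [Field F] [CharP F 2] (E : Type) [Field E] [Algebra F E]
    (a b c d : F) (α : E)
    (hα : α ^ 4 + algebraMap F E a * α ^ 3 + algebraMap F E b * α ^ 2
        + algebraMap F E c * α + algebraMap F E d = 0)
    (hdim : Module.finrank F E = 4)
    (hE : IntermediateField.adjoin F {α} = ⊤)
    (e : F) (he : e ≠ 0) (hfc : cubicResolvent F a b c d e ≠ 0) :
    InWqKernel F E (pf2 F (cubicResolvent F a b c d e) (d / e ^ 2)) := by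
  have : CharP E 2 := charP_of_injective_algebraMap (algebraMap F E).injective 2
  have h2 : (2 : E) = 0 := CharTwo.two_eq_zero
  have hα0 : α ≠ 0 := by
    rintro rfl
    rw [IntermediateField.adjoin_zero] at hE
    have h1 := IntermediateField.finrank_top' (F := F) (E := E)
    rw [← hE, IntermediateField.finrank_bot, hdim] at h1
    omega
  have he_map : algebraMap F E e ≠ 0 := by simpa using he
  refine wittEquiv_zero_of_represents (by simpa using hfc) ?_ (extQF_pf2_apply E _ _)
    (x := algebraMap F E e * α + algebraMap F E c)
    (y := algebraMap F E e * (algebraMap F E a + algebraMap F E e / α))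
  simp only [cubicResolvent, map_add, map_mul, map_pow, map_div₀]
  field_simp
  linear_combination algebraMap F E e ^ 2 * hα
    + (α * algebraMap F E e * algebraMap F E a * algebraMap F E d
      - α ^ 2 * algebraMap F E e ^ 2 * algebraMap F E b
      + α ^ 3 * algebraMap F E e * algebraMap F E c) * h2
end
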